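/- In the stochastic SQP setting with pre-specified stepsizes described in the context, assume ν ∈ (0, σ/(2(κ_v(τ_min·L + Γ) + 4))], fix K ∈ ℕ with K ≥ 1 and η > 0 with η/√K ≤ κ_β, and let β_k := η/√K for all 0 ≤ k ≤ K−1. Set κ₂ := τ_min·(f(x₀) − f_low) + ‖c(x₀)‖₁ + η²·κ₁. Then (1/K)·∑_{k=0}^{K−1} 𝔼[‖∇f(x_k) + J_kᵀ y_k^true‖²] ≤ κ_H²·κ₂/(τ_min·ζ·ν·η·√K) + 2·(1 + 2κ_u)·κ_v·κ_H²·κ₂/(ν·σ·K). -/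

import Mathlib

open Matrix MeasureTheory RealInnerProductSpace

/-- The ℓ¹-norm of a vector in `ℝ^m`. -/
noncomputable def l1Norm {k : ℕ} (v : EuclideanSpace ℝ (Fin k)) : ℝ := ∑ i, |v i|

/-- The Jacobian matrix of `c` at `z`, whose rows are the gradients of the components. -/
noncomputable def Jmat {m n : ℕ}
    (gradc : Fin m → EuclideanSpace ℝ (Fin n) → EuclideanSpace ℝ (Fin n))
    (z : EuclideanSpace ℝ (Fin n)) : Matrix (Fin m) (Fin n) ℝ :=
  Matrix.of fun i j => gradc i z j

section Taylor

variable {E : Type*} [NormedAddCommGroup E] [InnerProductSpace ℝ E] [CompleteSpace E]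

theorem le_quadratic_of_lipschitz_gradient {F : E → ℝ} {gradF : E → E} {L : ℝ}
    (hF : ∀ z, HasGradientAt F (gradF z) z)
    (hLip : ∀ z z', ‖gradF z - gradF z'‖ ≤ L * ‖z - z'‖) (x d : E) :
    F (x + d) ≤ F x + ⟪gradF x, d⟫ + L / 2 * ‖d‖ ^ 2 := by
  have hder : ∀ t : ℝ, HasDerivAt
      (fun t : ℝ => F (x + t • d) - t * ⟪gradF x, d⟫ - L / 2 * t ^ 2 * ‖d‖ ^ 2)
      (⟪gradF (x + t • d), d⟫ - ⟪gradF x, d⟫ - L * t * ‖d‖ ^ 2) t := by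
    intro t
    have hline : HasDerivAt (fun t : ℝ => x + t • d) d t := by
      simpa using ((hasDerivAt_id t).smul_const d).const_add x
    have h1 := (hF (x + t • d)).hasFDerivAt.comp_hasDerivAt t hline
    have h2 : HasDerivAt (fun t : ℝ => t * ⟪gradF x, d⟫) ⟪gradF x, d⟫ t := by
      simpa using (hasDerivAt_id t).mul_const ⟪gradF x, d⟫
    have h3 : HasDerivAt (fun t : ℝ => L / 2 * t ^ 2 * ‖d‖ ^ 2) (L * t * ‖d‖ ^ 2) t := by
      have := ((hasDerivAt_pow 2 t).const_mul (L / 2)).mul_const (‖d‖ ^ 2)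
      refine this.congr_deriv ?_
      push_cast
      ring
    refine ((h1.sub h2).sub h3).congr_deriv ?_
    simp
  have hanti : AntitoneOn
      (fun t : ℝ => F (x + t • d) - t * ⟪gradF x, d⟫ - L / 2 * t ^ 2 * ‖d‖ ^ 2)
      (Set.Icc 0 1) := by
    refine antitoneOn_of_deriv_nonpos (convex_Icc 0 1)
      (fun t _ => (hder t).continuousAt.continuousWithinAt)
      (fun t _ => (hder t).differentiableAt.differentiableWithinAt) ?_
    intro t ht
    rw [interior_Icc] at ht
    rw [(hder t).deriv, ← inner_sub_left]
    have h1 := real_inner_le_norm (gradF (x + t • d) - gradF x) d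
    have h2 := hLip (x + t • d) x
    rw [add_sub_cancel_left, norm_smul, Real.norm_of_nonneg ht.1.le] at h2
    nlinarith [mul_le_mul_of_nonneg_right h2 (norm_nonneg d)]
  have := hanti (Set.left_mem_Icc.2 zero_le_one) (Set.right_mem_Icc.2 zero_le_one) zero_le_one
  simp only [one_smul, zero_smul, add_zero] at this
  linarith

theorem abs_sub_linear_le_of_lipschitz_gradient {F : E → ℝ} {gradF : E → E} {L : ℝ}
    (hF : ∀ z, HasGradientAt F (gradF z) z)
    (hLip : ∀ z z', ‖gradF z - gradF z'‖ ≤ L * ‖z - z'‖) (x d : E) :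
    |F (x + d) - (F x + ⟪gradF x, d⟫)| ≤ L / 2 * ‖d‖ ^ 2 := by
  have hneg : ∀ z, HasGradientAt (fun z => -F z) (-gradF z) z := fun z => by
    have := (hF z).hasFDerivAt.neg
    rw [hasGradientAt_iff_hasFDerivAt, map_neg]
    exact this
  have h1 := le_quadratic_of_lipschitz_gradient hF hLip x d
  have h2 := le_quadratic_of_lipschitz_gradient (L := L) hneg
    (fun z z' => by rw [← norm_neg]; simpa [sub_eq_add_neg, add_comm] using hLip z z') x d
  rw [inner_neg_left] at h2
  rw [abs_le]
  constructor <;> linarith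

end Taylor

section L1Norm

variable {k : ℕ}

theorem l1Norm_nonneg (v : EuclideanSpace ℝ (Fin k)) : 0 ≤ l1Norm v :=
  Finset.sum_nonneg fun _ _ => abs_nonneg _

theorem continuous_l1Norm : Continuous (l1Norm (k := k)) := by
  unfold l1Norm
  fun_prop

theorem norm_le_l1Norm (v : EuclideanSpace ℝ (Fin k)) : ‖v‖ ≤ l1Norm v := by
  rw [EuclideanSpace.norm_eq]
  refine Real.sqrt_le_iff.2 ⟨l1Norm_nonneg v, ?_⟩
  simp only [Real.norm_eq_abs]
  exact Finset.sum_sq_le_sq_sum_of_nonneg fun i _ => abs_nonneg _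

theorem l1Norm_step_le {n : ℕ} {c : EuclideanSpace ℝ (Fin n) → EuclideanSpace ℝ (Fin k)}
    {gradc : Fin k → EuclideanSpace ℝ (Fin n) → EuclideanSpace ℝ (Fin n)} {γ : Fin k → ℝ}
    (hc : ∀ i z, HasGradientAt (fun w => c w i) (gradc i z) z)
    (hcLip : ∀ i z z', ‖gradc i z - gradc i z'‖ ≤ γ i * ‖z - z'‖)
    {x d : EuclideanSpace ℝ (Fin n)} (hd : Matrix.toEuclideanLin (Jmat gradc x) d = -c x)
    (t : ℝ) :
    l1Norm (c (x + t • d)) ≤ |1 - t| * l1Norm (c x) + (∑ i, γ i) / 2 * (t ^ 2 * ‖d‖ ^ 2) := by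
  have hcomp : ∀ i, ⟪gradc i x, d⟫ = -c x i := fun i => by
    rw [← PiLp.neg_apply, ← hd]
    simp [Jmat, Matrix.toLpLin_apply, Matrix.mulVec, dotProduct, PiLp.inner_apply, mul_comm]
  unfold l1Norm
  rw [Finset.mul_sum, Finset.sum_div, Finset.sum_mul, ← Finset.sum_add_distrib]
  refine Finset.sum_le_sum fun i _ => ?_
  have h := abs_sub_linear_le_of_lipschitz_gradient (hc i) (hcLip i) x (t • d)
  rw [inner_smul_right, hcomp, norm_smul, mul_pow, Real.norm_eq_abs, sq_abs] at h
  calc |c (x + t • d) i|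
      ≤ |c x i + t * -c x i| + |c (x + t • d) i - (c x i + t * -c x i)| := by
        simpa using abs_add_le (c x i + t * -c x i) (c (x + t • d) i - (c x i + t * -c x i))
    _ ≤ |1 - t| * |c x i| + γ i / 2 * (t ^ 2 * ‖d‖ ^ 2) := by
        refine add_le_add (le_of_eq ?_) h
        rw [← abs_mul]
        ring_nf

end L1Norm

section KKT

variable {E F : Type*} [NormedAddCommGroup E] [InnerProductSpace ℝ E]
  [NormedAddCommGroup F] [InnerProductSpace ℝ F]

theorem inner_range_adjoint_eq_zero {J : E →ₗ[ℝ] F} {Jt : F →ₗ[ℝ] E}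
    (hadj : ∀ z w, ⟪w, Jt z⟫ = ⟪J w, z⟫) {w : E} (hw : J w = 0) (z : F) : ⟪w, Jt z⟫ = 0 := by
  rw [hadj, hw, inner_zero_left]

theorem norm_normal_step_le {J : E →ₗ[ℝ] F} {Jt : F →ₗ[ℝ] E}
    (hadj : ∀ z w, ⟪w, Jt z⟫ = ⟪J w, z⟫) {s : ℝ} (hs : 0 < s)
    (hsv : ∀ z, s * ‖z‖ ≤ ‖Jt z‖) {v : E} {b : F} (hv : ∃ z, v = Jt z) (hJv : J v = -b) :
    ‖v‖ ≤ ‖b‖ / s := by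
  obtain ⟨z, rfl⟩ := hv
  rw [le_div_iff₀ hs]
  have h1 : ‖Jt z‖ ^ 2 ≤ ‖b‖ * ‖z‖ := by
    rw [← real_inner_self_eq_norm_sq, hadj, hJv, ← norm_neg b]
    exact real_inner_le_norm _ _
  rcases (norm_nonneg (Jt z)).eq_or_lt with h0 | h0
  · rw [← h0, zero_mul]
    exact norm_nonneg b
  · refine le_of_mul_le_mul_right ?_ h0
    nlinarith [mul_le_mul_of_nonneg_left (hsv z) (norm_nonneg b)]

theorem inner_eq_of_kkt {H : E →ₗ[ℝ] E} {J : E →ₗ[ℝ] F} {Jt : F →ₗ[ℝ] E}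
    (hadj : ∀ z w, ⟪w, Jt z⟫ = ⟪J w, z⟫) {w r : E} {q : F} (hw : J w = 0)
    (hsys : H w + Jt q = r) : ⟪w, H w⟫ = ⟪w, r⟫ := by
  rw [← hsys, inner_add_right, inner_range_adjoint_eq_zero hadj hw, add_zero]

theorem mul_norm_le_of_kkt {H : E →ₗ[ℝ] E} {J : E →ₗ[ℝ] F} {Jt : F →ₗ[ℝ] E}
    (hadj : ∀ z w, ⟪w, Jt z⟫ = ⟪J w, z⟫) {ζ : ℝ}
    (hpd : ∀ w, J w = 0 → ζ * ‖w‖ ^ 2 ≤ ⟪w, H w⟫) {w r : E} {q : F} (hw : J w = 0)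
    (hsys : H w + Jt q = r) : ζ * ‖w‖ ≤ ‖r‖ := by
  have h1 := hpd w hw
  rw [inner_eq_of_kkt hadj hw hsys] at h1
  rcases (norm_nonneg w).eq_or_lt with h0 | h0
  · rw [← h0, mul_zero]
    exact norm_nonneg r
  · refine le_of_mul_le_mul_right ?_ h0
    nlinarith [real_inner_le_norm w r]

end KKT

theorem inner_toEuclideanLin_transpose {m n : ℕ} (A : Matrix (Fin m) (Fin n) ℝ)
    (z : EuclideanSpace ℝ (Fin m)) (w : EuclideanSpace ℝ (Fin n)) :
    ⟪w, Matrix.toEuclideanLin Aᵀ z⟫ = ⟪Matrix.toEuclideanLin A w, z⟫ := by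
  rw [← Matrix.conjTranspose_eq_transpose_of_trivial, Matrix.toEuclideanLin_conjTranspose_eq_adjoint,
    LinearMap.adjoint_inner_right]

theorem exists_measurable_mulVec_eq {Ω ι : Type*} [Fintype ι] [DecidableEq ι]
    (m' : MeasurableSpace Ω) {A : Ω → Matrix ι ι ℝ} {b : Ω → ι → ℝ}
    (hA : ∀ i j, Measurable[m'] fun ω => A ω i j) (hb : ∀ i, Measurable[m'] fun ω => b ω i)
    (hdet : ∀ ω, (A ω).det ≠ 0) :
    ∃ p : Ω → ι → ℝ, (∀ i, Measurable[m'] fun ω => p ω i) ∧ ∀ ω, A ω *ᵥ p ω = b ω := by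
  have hA' : Measurable[m'] fun ω i j => A ω i j :=
    measurable_pi_iff.2 fun i => measurable_pi_iff.2 fun j => hA i j
  have hdetmeas : Measurable[m'] fun ω => (A ω).det :=
    (show Continuous fun B : ι → ι → ℝ => (Matrix.of B).det from
      Continuous.matrix_det continuous_id).measurable.comp hA'
  have hadjmeas : ∀ i j, Measurable[m'] fun ω => (A ω).adjugate i j := fun i j =>
    (show Continuous fun B : ι → ι → ℝ => (Matrix.of B).adjugate i j from
      (Continuous.matrix_adjugate continuous_id).matrix_elem i j).measurable.comp hA'
  refine ⟨fun ω => (A ω).det⁻¹ • ((A ω).adjugate *ᵥ b ω), fun i => ?_, fun ω => ?_⟩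
  · exact hdetmeas.inv.mul
      (Finset.measurable_fun_sum _ fun j _ => (hadjmeas i j).mul (hb j))
  · rw [Matrix.mulVec_smul, Matrix.mulVec_mulVec, Matrix.mul_adjugate, Matrix.smul_mulVec,
      Matrix.one_mulVec, smul_smul, inv_mul_cancel₀ (hdet ω), one_smul]

theorem kkt_det_ne_zero {m n : ℕ} {H : Matrix (Fin n) (Fin n) ℝ} {J : Matrix (Fin m) (Fin n) ℝ}
    {s ζ : ℝ} (hs : 0 < s) (hζ : 0 < ζ)
    (hpd : ∀ z : EuclideanSpace ℝ (Fin n), Matrix.toEuclideanLin J z = 0 →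
      ζ * ‖z‖ ^ 2 ≤ ⟪z, Matrix.toEuclideanLin H z⟫)
    (hsv : ∀ z : EuclideanSpace ℝ (Fin m), s * ‖z‖ ≤ ‖Matrix.toEuclideanLin Jᵀ z‖) :
    (Matrix.fromBlocks H Jᵀ J 0).det ≠ 0 := by
  intro h0
  obtain ⟨z, hz0, hz⟩ := Matrix.exists_mulVec_eq_zero_iff.2 h0
  refine hz0 ?_
  rw [Matrix.fromBlocks_mulVec] at hz
  have e1 : Matrix.toEuclideanLin H (WithLp.toLp 2 (z ∘ Sum.inl))
      + Matrix.toEuclideanLin Jᵀ (WithLp.toLp 2 (z ∘ Sum.inr)) = 0 := by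
    ext i
    simpa [Matrix.toLpLin_apply] using congrFun hz (Sum.inl i)
  have e2 : Matrix.toEuclideanLin J (WithLp.toLp 2 (z ∘ Sum.inl)) = 0 := by
    ext i
    simpa [Matrix.toLpLin_apply] using congrFun hz (Sum.inr i)
  have n1 := mul_norm_le_of_kkt (inner_toEuclideanLin_transpose J) hpd e2 e1
  rw [norm_zero] at n1
  have z1 := norm_le_zero_iff.1 (nonpos_of_mul_nonpos_right n1 hζ)
  have n2 := hsv (WithLp.toLp 2 (z ∘ Sum.inr))
  rw [z1, map_zero, zero_add] at e1
  rw [e1, norm_zero] at n2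
  have z2 := norm_le_zero_iff.1 (nonpos_of_mul_nonpos_right n2 hs)
  funext i
  rcases i with i | i
  · simpa using congrArg (fun y : EuclideanSpace ℝ (Fin n) => y i) z1
  · simpa using congrArg (fun y : EuclideanSpace ℝ (Fin m) => y i) z2

/-- The linear system with the transposed KKT matrix has a measurable solution. -/
theorem exists_measurable_adjoint_kkt {Ω : Type*} {m n : ℕ} (m' : MeasurableSpace Ω)
    {H : Ω → Matrix (Fin n) (Fin n) ℝ} {J : Ω → Matrix (Fin m) (Fin n) ℝ}
    {a : Ω → EuclideanSpace ℝ (Fin n)} {s ζ : ℝ} (hs : 0 < s) (hζ : 0 < ζ)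
    (hH : ∀ i j, Measurable[m'] fun ω => H ω i j) (hJ : ∀ i j, Measurable[m'] fun ω => J ω i j)
    (ha : ∀ i, Measurable[m'] fun ω => a ω i)
    (hpd : ∀ ω (z : EuclideanSpace ℝ (Fin n)), Matrix.toEuclideanLin (J ω) z = 0 →
      ζ * ‖z‖ ^ 2 ≤ ⟪z, Matrix.toEuclideanLin (H ω) z⟫)
    (hsv : ∀ ω (z : EuclideanSpace ℝ (Fin m)),
      s * ‖z‖ ≤ ‖Matrix.toEuclideanLin (J ω)ᵀ z‖) :
    ∃ (w : Ω → EuclideanSpace ℝ (Fin n)) (q : Ω → EuclideanSpace ℝ (Fin m)),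
      StronglyMeasurable[m'] w ∧ ∀ ω, Matrix.toEuclideanLin (J ω) (w ω) = 0 ∧
        Matrix.toEuclideanLin (H ω)ᵀ (w ω) + Matrix.toEuclideanLin (J ω)ᵀ (q ω) = a ω := by
  obtain ⟨p, hpmeas, hp⟩ := exists_measurable_mulVec_eq m'
    (A := fun ω => Matrix.fromBlocks (H ω)ᵀ (J ω)ᵀ (J ω) 0)
    (b := fun ω => Sum.elim (a ω) 0)
    (by
      rintro (i | i) (j | j)
      · exact hH j i
      · exact hJ j i
      · exact hJ i j
      · exact measurable_const)
    (by
      rintro (i | i)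
      · exact ha i
      · exact measurable_const)
    (fun ω => kkt_det_ne_zero hs hζ (fun z hz => by
      rw [inner_toEuclideanLin_transpose, real_inner_comm]
      exact hpd ω z hz) (hsv ω))
  refine ⟨fun ω => WithLp.toLp 2 (p ω ∘ Sum.inl), fun ω => WithLp.toLp 2 (p ω ∘ Sum.inr), ?_,
    fun ω => ⟨?_, ?_⟩⟩
  · have : Measurable[m'] fun ω => WithLp.toLp 2 (p ω ∘ Sum.inl) :=
      (WithLp.measurable_toLp 2 _).comp (measurable_pi_iff.2 fun i => hpmeas (Sum.inl i))
    exact this.stronglyMeasurable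
  · have := hp ω
    rw [Matrix.fromBlocks_mulVec] at this
    ext i
    simpa [Matrix.toLpLin_apply] using congrFun this (Sum.inr i)
  · have := hp ω
    rw [Matrix.fromBlocks_mulVec] at this
    ext i
    simpa [Matrix.toLpLin_apply] using congrFun this (Sum.inl i)

section Probability

variable {Ω : Type*} {m0 : MeasurableSpace Ω} {μ : Measure Ω} [IsProbabilityMeasure μ]

theorem integral_inner_eq_zero_of_condExp_eq_zero {E : Type*} [NormedAddCommGroup E]
    [InnerProductSpace ℝ E] [CompleteSpace E] {m' : MeasurableSpace Ω} (hm' : m' ≤ m0)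
    {w e : Ω → E} (hw : StronglyMeasurable[m'] w) (he : Integrable e μ)
    (hcond : μ[e | m'] =ᵐ[μ] 0) {C : ℝ} (hC : ∀ ω, ‖w ω‖ ≤ C) :
    Integrable (fun ω => ⟪w ω, e ω⟫) μ ∧ ∫ ω, ⟪w ω, e ω⟫ ∂μ = 0 := by
  refine ⟨(innerSL ℝ).integrable_of_bilin_of_bdd_left C (hw.mono hm').aestronglyMeasurable
    (ae_of_all _ hC) he, ?_⟩
  have h := condExp_stronglyMeasurable_bilin_of_bound (innerSL ℝ) hm' hw he C (ae_of_all μ hC)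
  rw [← integral_condExp hm']
  refine integral_eq_zero_of_ae (h.trans ?_)
  filter_upwards [hcond] with ω hω
  simp [hω]

theorem integral_sq_le_of_condExp_le {m' : MeasurableSpace Ω} (hm' : m' ≤ m0) {h : Ω → ℝ} {M : ℝ}
    (hle : ∀ᵐ ω ∂μ, (μ[h | m']) ω ≤ M) : ∫ ω, h ω ∂μ ≤ M := by
  rw [← integral_condExp hm']
  calc ∫ ω, (μ[h | m']) ω ∂μ ≤ ∫ _, M ∂μ :=
        integral_mono_ae integrable_condExp (integrable_const M) hle
    _ = M := by simp

theorem integral_le_sqrt_of_integral_sq_le {h : Ω → ℝ} (hint : Integrable h μ)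
    (hint2 : Integrable (fun ω => h ω ^ 2) μ) {M : ℝ} (hM : 0 < M) (hle : ∫ ω, h ω ^ 2 ∂μ ≤ M) :
    ∫ ω, h ω ∂μ ≤ Real.sqrt M := by
  have hs : 0 < Real.sqrt M := Real.sqrt_pos.2 hM
  have h1 : ∫ ω, 2 * Real.sqrt M * h ω ∂μ ≤ ∫ ω, h ω ^ 2 + M ∂μ := by
    refine integral_mono (hint.const_mul _) (hint2.add (integrable_const M)) fun ω => ?_
    nlinarith [sq_nonneg (h ω - Real.sqrt M), Real.sq_sqrt hM.le]
  rw [integral_const_mul, integral_add hint2 (integrable_const M)] at h1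
  simp only [integral_const, probReal_univ, smul_eq_mul, one_mul] at h1
  refine le_of_mul_le_mul_left ?_ hs
  nlinarith [Real.mul_self_sqrt hM.le]

/-- The tangential error of a KKT system with zero-mean noise in the right-hand side is
uncorrelated with every bounded variable that is measurable with respect to the past. -/
theorem integral_inner_tangential_error_eq_zero {m n : ℕ} {m' : MeasurableSpace Ω} (hm' : m' ≤ m0)
    {H : Ω → Matrix (Fin n) (Fin n) ℝ} {J : Ω → Matrix (Fin m) (Fin n) ℝ}
    {a e δ : Ω → EuclideanSpace ℝ (Fin n)} {r : Ω → EuclideanSpace ℝ (Fin m)} {s ζ C : ℝ}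
    (hs : 0 < s) (hζ : 0 < ζ)
    (hH : ∀ i j, Measurable[m'] fun ω => H ω i j) (hJ : ∀ i j, Measurable[m'] fun ω => J ω i j)
    (ha : StronglyMeasurable[m'] a) (haC : ∀ ω, ‖a ω‖ ≤ C)
    (hpd : ∀ ω (z : EuclideanSpace ℝ (Fin n)), Matrix.toEuclideanLin (J ω) z = 0 →
      ζ * ‖z‖ ^ 2 ≤ ⟪z, Matrix.toEuclideanLin (H ω) z⟫)
    (hsv : ∀ ω (z : EuclideanSpace ℝ (Fin m)),
      s * ‖z‖ ≤ ‖Matrix.toEuclideanLin (J ω)ᵀ z‖)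
    (he : Integrable e μ) (hcond : μ[e | m'] =ᵐ[μ] 0)
    (hδ : ∀ ω, Matrix.toEuclideanLin (J ω) (δ ω) = 0)
    (hsys : ∀ ω, Matrix.toEuclideanLin (H ω) (δ ω) + Matrix.toEuclideanLin (J ω)ᵀ (r ω)
      = -e ω) :
    Integrable (fun ω => ⟪a ω, δ ω⟫) μ ∧ ∫ ω, ⟪a ω, δ ω⟫ ∂μ = 0 := by
  have hai : ∀ i, Measurable[m'] fun ω => a ω i := fun i =>
    ((EuclideanSpace.proj (𝕜 := ℝ) i).continuous.comp_stronglyMeasurable ha).measurable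
  obtain ⟨w, q, hw, hwq⟩ := exists_measurable_adjoint_kkt m' hs hζ hH hJ hai hpd hsv
  have hpd' : ∀ ω (z : EuclideanSpace ℝ (Fin n)), Matrix.toEuclideanLin (J ω) z = 0 →
      ζ * ‖z‖ ^ 2 ≤ ⟪z, Matrix.toEuclideanLin (H ω)ᵀ z⟫ := fun ω z hz => by
    rw [inner_toEuclideanLin_transpose, real_inner_comm]
    exact hpd ω z hz
  have hwC : ∀ ω, ‖w ω‖ ≤ C / ζ := fun ω => by
    rw [le_div_iff₀ hζ, mul_comm]
    exact (mul_norm_le_of_kkt (inner_toEuclideanLin_transpose (J ω)) (hpd' ω) (hwq ω).1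
      (hwq ω).2).trans (haC ω)
  have hdual : (fun ω => ⟪a ω, δ ω⟫) = fun ω => -⟪w ω, e ω⟫ := by
    funext ω
    have hHδ : Matrix.toEuclideanLin (H ω) (δ ω)
        = -e ω - Matrix.toEuclideanLin (J ω)ᵀ (r ω) := eq_sub_of_add_eq (hsys ω)
    rw [← (hwq ω).2, real_inner_comm, inner_add_right,
      inner_range_adjoint_eq_zero (inner_toEuclideanLin_transpose (J ω)) (hδ ω), add_zero,
      inner_toEuclideanLin_transpose, hHδ, real_inner_comm, inner_sub_right,
      inner_range_adjoint_eq_zero (inner_toEuclideanLin_transpose (J ω)) (hwq ω).1, sub_zero,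
      inner_neg_right]
  have := integral_inner_eq_zero_of_condExp_eq_zero hm' hw he hcond hwC
  rw [hdual]
  exact ⟨this.1.neg, by rw [integral_neg, this.2, neg_zero]⟩

theorem integral_descent_of_pointwise_descent {Φ' Φ T C D X E E2 : Ω → ℝ}
    {t c a₁ a₂ a₃ a₄ a₅ e₁ e₂ : ℝ}
    (hΦ' : Integrable Φ' μ) (hΦ : Integrable Φ μ) (hT : Integrable T μ) (hC : Integrable C μ)
    (hD : Integrable D μ) (hX : Integrable X μ) (hE : Integrable E μ) (hE2 : Integrable E2 μ)
    (hD0 : ∫ ω, D ω ∂μ = 0) (hX0 : ∫ ω, X ω ∂μ = 0) (hEe : ∫ ω, E ω ∂μ ≤ e₁)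
    (hE2e : ∫ ω, E2 ω ∂μ ≤ e₂) (ha₃ : 0 ≤ a₃) (ha₄ : 0 ≤ a₄)
    (h : ∀ ω, Φ' ω + t * T ω + c * C ω
      ≤ Φ ω + a₁ * D ω + a₂ * X ω + a₃ * E ω + a₄ * E2 ω + a₅) :
    ∫ ω, Φ' ω ∂μ + t * ∫ ω, T ω ∂μ + c * ∫ ω, C ω ∂μ
      ≤ ∫ ω, Φ ω ∂μ + a₃ * e₁ + a₄ * e₂ + a₅ := by
  have i1 := hΦ'.add (hT.const_mul t)
  have j1 := hΦ.add (hD.const_mul a₁)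
  have j2 := j1.add (hX.const_mul a₂)
  have j3 := j2.add (hE.const_mul a₃)
  have j4 := j3.add (hE2.const_mul a₄)
  have key := integral_mono (i1.add (hC.const_mul c)) (j4.add (integrable_const a₅)) h
  rw [integral_add' i1 (hC.const_mul c), integral_add' hΦ' (hT.const_mul t),
    integral_add' j4 (integrable_const a₅), integral_add' j3 (hE2.const_mul a₄),
    integral_add' j2 (hE.const_mul a₃), integral_add' j1 (hX.const_mul a₂),
    integral_add' hΦ (hD.const_mul a₁)] at key
  simp only [integral_const_mul, integral_const, probReal_univ, smul_eq_mul, one_mul, hD0, hX0,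
    mul_zero, add_zero] at key
  linarith [mul_le_mul_of_nonneg_left hEe ha₃, mul_le_mul_of_nonneg_left hE2e ha₄]

end Probability

/-- The one-step decrease of the merit function, in terms of the scalar quantities involved. -/
theorem merit_step_le {F₀ F₁ C₀ C₁ α β ν θ κβ σ τ L Γ ζ κg κc κv G Gv D T U V X E P : ℝ}
    (hν : 0 < ν) (hθ : 0 < θ) (hβ : 0 < β) (hβb : β ≤ κβ) (hσ : 0 < σ) (hτ : 0 < τ)
    (hL : 0 < L) (hΓ : 0 ≤ Γ) (hζ : 0 < ζ) (hκv : 0 < κv)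
    (hα : α ∈ Set.Icc ν (ν + θ * β)) (hνb : ν * (κv * (τ * L + Γ) + 4) ≤ σ / 2)
    (hF : F₁ ≤ F₀ + α * (β * (G + D) + Gv) + L / 2 * (α ^ 2 * (β ^ 2 * U + V)))
    (hC : C₁ ≤ |1 - α| * C₀ + Γ / 2 * (α ^ 2 * (β ^ 2 * U + V)))
    (hmodel : τ * (β * G + Gv) ≤ -(τ * β * ζ * T) + (1 - σ) * C₀)
    (hD : D ≤ κg * (ζ⁻¹ * E)) (hE : 0 ≤ κg * (ζ⁻¹ * E)) (hT : 0 ≤ T)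
    (hV : V ≤ κv * C₀) (hC0 : 0 ≤ C₀) (hCb : C₀ ≤ κc) (hU0 : 0 ≤ U)
    (hU : U ≤ P + 2 * X + ζ⁻¹ ^ 2 * E ^ 2) :
    τ * F₁ + C₁ + ν * τ * β * ζ * T + ν * σ / 2 * C₀
      ≤ τ * F₀ + C₀ + ν * τ * β * D + (ν + θ * κβ) ^ 2 * (τ * L + Γ) * β ^ 2 * X
        + τ * θ * β ^ 2 * κg * ζ⁻¹ * E
        + (ν + θ * κβ) ^ 2 * (τ * L + Γ) * β ^ 2 / 2 * ζ⁻¹ ^ 2 * E ^ 2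
        + (β ^ 2 * θ ^ 2 * κc * (κv * (τ * L + Γ) + 4)
          + (ν + θ * κβ) ^ 2 * (τ * L + Γ) * β ^ 2 / 2 * P) := by
  obtain ⟨hα1, hα2⟩ := hα
  obtain ⟨Λ, hΛ⟩ : ∃ Λ, Λ = τ * L + Γ := ⟨_, rfl⟩
  have hΛ0 : 0 < Λ := by rw [hΛ]; positivity
  rw [← hΛ] at hνb ⊢
  obtain ⟨a, ha⟩ : ∃ a, a = α - ν := ⟨_, rfl⟩
  have ha0 : 0 ≤ a := by linarith
  have haθ : a ≤ θ * β := by linarith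
  have hα0 : 0 < α := by linarith
  have hαb : α ≤ ν + θ * κβ := by nlinarith
  have ha2 : a ^ 2 ≤ (θ * β) ^ 2 := pow_le_pow_left₀ ha0 haθ 2
  have hα2' : α ^ 2 ≤ 2 * (ν ^ 2 + a ^ 2) := by
    have : α = ν + a := by linarith
    rw [this]
    nlinarith [sq_nonneg (ν - a)]
  have habs : |1 - α| ≤ 1 - α + (ν ^ 2 + a ^ 2) := by
    rw [abs_le]
    constructor
    · linarith [sq_nonneg (α - 2), sub_sq α 2]
    · linarith [sq_nonneg ν, sq_nonneg a]
  have s1 : τ * F₁ + C₁ ≤ τ * F₀ + C₀ + α * (τ * (β * G + Gv) - C₀) + (ν ^ 2 + a ^ 2) * C₀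
      + α * (τ * β * D) + Λ / 2 * (α ^ 2 * (β ^ 2 * U)) + Λ / 2 * (α ^ 2 * V) := by
    have h1 := mul_le_mul_of_nonneg_left hF hτ.le
    have h2 := mul_le_mul_of_nonneg_right habs hC0
    rw [hΛ]
    linarith
  have s2 : α * (τ * (β * G + Gv) - C₀) ≤ ν * (-(τ * β * ζ * T) - σ * C₀) := by
    have h1 : τ * (β * G + Gv) - C₀ ≤ -(τ * β * ζ * T) - σ * C₀ := by linarith
    have h2 : 0 ≤ τ * β * ζ * T := by positivity
    have h3 : 0 ≤ σ * C₀ := by positivity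
    have h4 : -(τ * β * ζ * T) - σ * C₀ ≤ 0 := by linarith
    calc α * (τ * (β * G + Gv) - C₀) ≤ α * (-(τ * β * ζ * T) - σ * C₀) :=
          mul_le_mul_of_nonneg_left h1 hα0.le
      _ ≤ ν * (-(τ * β * ζ * T) - σ * C₀) := mul_le_mul_of_nonpos_right hα1 h4
  have s3 : α * (τ * β * D) ≤ ν * τ * β * D + τ * θ * β ^ 2 * κg * ζ⁻¹ * E := by
    have h1 : a * (τ * β * D) ≤ a * (τ * β * (κg * (ζ⁻¹ * E))) := by gcongr
    have h2 : a * (τ * β * (κg * (ζ⁻¹ * E))) ≤ θ * β * (τ * β * (κg * (ζ⁻¹ * E))) := by gcongr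
    have h3 : α = ν + a := by linarith
    rw [h3]
    linarith
  have s4 : Λ / 2 * (α ^ 2 * (β ^ 2 * U))
      ≤ (ν + θ * κβ) ^ 2 * Λ * β ^ 2 / 2 * (P + 2 * X + ζ⁻¹ ^ 2 * E ^ 2) := by
    calc Λ / 2 * (α ^ 2 * (β ^ 2 * U)) ≤ Λ / 2 * ((ν + θ * κβ) ^ 2 * (β ^ 2 * U)) := by gcongr
      _ ≤ Λ / 2 * ((ν + θ * κβ) ^ 2 * (β ^ 2 * (P + 2 * X + ζ⁻¹ ^ 2 * E ^ 2))) := by gcongr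
      _ = _ := by ring
  have s5 : (ν ^ 2 + a ^ 2) * C₀ + Λ / 2 * (α ^ 2 * V)
      ≤ ν * σ / 2 * C₀ + β ^ 2 * θ ^ 2 * κc * (κv * Λ + 4) := by
    calc (ν ^ 2 + a ^ 2) * C₀ + Λ / 2 * (α ^ 2 * V)
        ≤ (ν ^ 2 + a ^ 2) * C₀ + Λ / 2 * (2 * (ν ^ 2 + a ^ 2) * (κv * C₀)) := by
          refine add_le_add_right (mul_le_mul_of_nonneg_left ?_ (by positivity)) _
          calc α ^ 2 * V ≤ α ^ 2 * (κv * C₀) := by gcongr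
            _ ≤ _ := by gcongr
      _ = (ν ^ 2 + a ^ 2) * (κv * Λ + 1) * C₀ := by ring
      _ ≤ (ν ^ 2 + (θ * β) ^ 2) * (κv * Λ + 4) * C₀ := by gcongr; norm_num
      _ = ν * (ν * (κv * Λ + 4)) * C₀ + (θ * β) ^ 2 * (κv * Λ + 4) * C₀ := by ring
      _ ≤ ν * (σ / 2) * C₀ + (θ * β) ^ 2 * (κv * Λ + 4) * κc := by gcongr
      _ = _ := by ring
  linarith

/-- Complexity bound on the average expected squared norm of the
gradient of the Lagrangian for the two-stepsize stochastic SQP method with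
pre-specified stepsizes. -/
theorem stmt11 {m n : ℕ} (hm : 1 ≤ m) (hmn : m ≤ n)
    {Ω : Type*} {m0 : MeasurableSpace Ω} (μ : Measure Ω) [IsProbabilityMeasure μ]
    (ℱ : Filtration ℕ m0)
    -- problem data
    (f : EuclideanSpace ℝ (Fin n) → ℝ)
    (gradf : EuclideanSpace ℝ (Fin n) → EuclideanSpace ℝ (Fin n))
    (c : EuclideanSpace ℝ (Fin n) → EuclideanSpace ℝ (Fin m))
    (gradc : Fin m → EuclideanSpace ℝ (Fin n) → EuclideanSpace ℝ (Fin n))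
    (flow L κg κc s ζ κH M ν θ κβ σ : ℝ) (γ : Fin m → ℝ)
    (hL : 0 < L) (hκg : 0 < κg) (hκc : 0 < κc) (hs : 0 < s) (hζ : 0 < ζ)
    (hκH : 0 < κH) (hM : 0 < M) (hθ : 0 < θ) (hκβ : 0 < κβ)
    (hσ : σ ∈ Set.Ioo (0 : ℝ) 1) (hγ : ∀ i, 0 < γ i)
    (hf : ∀ z, HasGradientAt f (gradf z) z)
    (hflow : ∀ z, flow ≤ f z)
    (hfLip : ∀ z z', ‖gradf z - gradf z'‖ ≤ L * ‖z - z'‖)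
    (hgradb : ∀ z, ‖gradf z‖ ≤ κg)
    (hc : ∀ i z, HasGradientAt (fun w => c w i) (gradc i z) z)
    (hcb : ∀ z, l1Norm (c z) ≤ κc)
    (hcLip : ∀ i z z', ‖gradc i z - gradc i z'‖ ≤ γ i * ‖z - z'‖)
    -- algorithm iterates
    (x0 : EuclideanSpace ℝ (Fin n))
    (x u utrue g v : ℕ → Ω → EuclideanSpace ℝ (Fin n))
    (y ytrue : ℕ → Ω → EuclideanSpace ℝ (Fin m))
    (H : ℕ → Ω → Matrix (Fin n) (Fin n) ℝ)
    (α : ℕ → Ω → ℝ) (β : ℕ → ℝ)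
    (hx0 : ∀ ω, x 0 ω = x0)
    (hxmeas : ∀ k, StronglyMeasurable[ℱ k] (x k))
    (hHmeas : ∀ k i j, StronglyMeasurable[ℱ k] (fun ω => H k ω i j))
    (hHnorm : ∀ k ω (z : EuclideanSpace ℝ (Fin n)),
      ‖Matrix.toEuclideanLin (H k ω) z‖ ≤ κH * ‖z‖)
    (hHpd : ∀ k ω (z : EuclideanSpace ℝ (Fin n)),
      Matrix.toEuclideanLin (Jmat gradc (x k ω)) z = 0 →
      ζ * ‖z‖ ^ 2 ≤ ⟪z, Matrix.toEuclideanLin (H k ω) z⟫)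
    (hsv : ∀ k ω (z : EuclideanSpace ℝ (Fin m)),
      s * ‖z‖ ≤ ‖Matrix.toEuclideanLin (Jmat gradc (x k ω))ᵀ z‖)
    (hgmeas : ∀ k, StronglyMeasurable[ℱ (k + 1)] (g k))
    (hgmean : ∀ k, μ[g k | ℱ k] =ᵐ[μ] fun ω => gradf (x k ω))
    (hgvarint : ∀ k, Integrable (fun ω => ‖g k ω - gradf (x k ω)‖ ^ 2) μ)
    (hgvar : ∀ k, ∀ᵐ ω ∂μ,
      (μ[fun ω' => ‖g k ω' - gradf (x k ω')‖ ^ 2 | ℱ k]) ω ≤ M)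
    (humeas : ∀ k, StronglyMeasurable[ℱ (k + 1)] (u k))
    (hymeas : ∀ k, StronglyMeasurable[ℱ (k + 1)] (y k))
    (hvmeas : ∀ k, StronglyMeasurable[ℱ k] (v k))
    (hutmeas : ∀ k, StronglyMeasurable[ℱ k] (utrue k))
    (hytmeas : ∀ k, StronglyMeasurable[ℱ k] (ytrue k))
    (hJu : ∀ k ω, Matrix.toEuclideanLin (Jmat gradc (x k ω)) (u k ω) = 0)
    (hvrange : ∀ k ω, ∃ z : EuclideanSpace ℝ (Fin m),
      v k ω = Matrix.toEuclideanLin (Jmat gradc (x k ω))ᵀ z)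
    (hJp : ∀ k ω, Matrix.toEuclideanLin (Jmat gradc (x k ω)) (u k ω + v k ω)
      = -(c (x k ω)))
    (hsys : ∀ k ω, Matrix.toEuclideanLin (H k ω) (u k ω + v k ω)
      + Matrix.toEuclideanLin (Jmat gradc (x k ω))ᵀ (y k ω) = -(g k ω))
    (hJut : ∀ k ω, Matrix.toEuclideanLin (Jmat gradc (x k ω)) (utrue k ω) = 0)
    (hsyst : ∀ k ω, Matrix.toEuclideanLin (H k ω) (utrue k ω + v k ω)
      + Matrix.toEuclideanLin (Jmat gradc (x k ω))ᵀ (ytrue k ω) = -(gradf (x k ω)))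
    (hβpos : ∀ k, 0 < β k) (hβb : ∀ k, β k ≤ κβ)
    (hαmeas : ∀ k, StronglyMeasurable[ℱ (k + 1)] (α k))
    (hα : ∀ k ω, α k ω ∈ Set.Icc ν (ν + θ * β k))
    (hupdate : ∀ k ω, x (k + 1) ω = x k ω + α k ω • (β k • u k ω + v k ω))
    -- constants
    (κv κu τmin Γ κ₁ : ℝ)
    (hκv : κv = max (1 / s) (κc / s ^ 2))
    (hκu : κu = ζ⁻¹ * κg + ζ⁻¹ * κH * κv * κc)
    (hΓ : Γ = ∑ i, γ i)
    (hτmin : τmin = (1 - σ) / (κv * (κβ * κH * κu + κg)))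
    (hν : ν ∈ Set.Ioc (0 : ℝ) (σ / (2 * (κv * (τmin * L + Γ) + 4))))
    (hκ₁ : κ₁ = (ν + θ * κβ) ^ 2 * (τmin * L + Γ) * (ζ⁻¹ * κH * κu ^ 2 + ζ⁻¹ ^ 2 * M) / 2
      + θ * (θ * κc * (κv * (τmin * L + Γ) + 4) + τmin * κg * ζ⁻¹ * Real.sqrt M))
    (K : ℕ) (hK : 1 ≤ K) (η : ℝ) (hη : 0 < η)
    (hηβ : η / Real.sqrt K ≤ κβ)
    (hβK : ∀ k < K, β k = η / Real.sqrt K)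
    (κ₂ : ℝ) (hκ₂ : κ₂ = τmin * (f x0 - flow) + l1Norm (c x0) + η ^ 2 * κ₁) :
    (1 / (K : ℝ)) * ∑ k ∈ Finset.range K,
      ∫ ω, ‖gradf (x k ω)
        + Matrix.toEuclideanLin (Jmat gradc (x k ω))ᵀ (ytrue k ω)‖ ^ 2 ∂μ
      ≤ κH ^ 2 * κ₂ / (τmin * ζ * ν * η * Real.sqrt K)
        + 2 * (1 + 2 * κu) * κv * κH ^ 2 * κ₂ / (ν * σ * K) := by
  obtain ⟨hσ0, hσ1⟩ := hσ
  obtain ⟨hν0, hνb⟩ := hν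
  have hκv0 : 0 < κv := by
    rw [hκv]
    exact lt_max_of_lt_left (by positivity)
  have hκu0 : 0 < κu := by rw [hκu]; positivity
  have hτ : 0 < τmin := by
    rw [hτmin]
    exact div_pos (by linarith) (by positivity)
  have hΓ0 : 0 ≤ Γ := by
    rw [hΓ]
    exact Finset.sum_nonneg fun i _ => (hγ i).le
  have hνb' : ν * (κv * (τmin * L + Γ) + 4) ≤ σ / 2 := by
    rw [le_div_iff₀ (by positivity)] at hνb
    linarith
  have hαb : ∀ k ω, 0 ≤ α k ω ∧ α k ω ≤ ν + θ * κβ := fun k ω => by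
    have h1 := mul_le_mul_of_nonneg_left (hβb k) hθ.le
    exact ⟨hν0.le.trans (hα k ω).1, by linarith [(hα k ω).2]⟩
  -- measurability of the data along the iterates
  have hgradfc : Continuous gradf :=
    (LipschitzWith.of_dist_le' fun z z' => by
      simpa only [dist_eq_norm] using hfLip z z').continuous
  have hgradcc : ∀ i, Continuous (gradc i) := fun i =>
    (LipschitzWith.of_dist_le' fun z z' => by
      simpa only [dist_eq_norm] using hcLip i z z').continuous
  have hfc : Continuous f :=
    continuous_iff_continuousAt.2 fun z => (hf z).differentiableAt.continuousAt
  have hcc : Continuous c :=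
    (PiLp.continuous_toLp 2 _).comp (continuous_pi fun i =>
      continuous_iff_continuousAt.2 fun z => (hc i z).differentiableAt.continuousAt)
  have hgf : ∀ k, StronglyMeasurable[ℱ k] fun ω => gradf (x k ω) := fun k =>
    hgradfc.comp_stronglyMeasurable (hxmeas k)
  have hJmeas : ∀ k i j, Measurable[ℱ k] fun ω => Jmat gradc (x k ω) i j := fun k i j =>
    (((EuclideanSpace.proj (𝕜 := ℝ) j).continuous.comp (hgradcc i)).comp_stronglyMeasurable
      (hxmeas k)).measurable
  -- deterministic bounds on the steps
  have hadj := fun k ω => inner_toEuclideanLin_transpose (Jmat gradc (x k ω))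
  have hJv : ∀ k ω, Matrix.toEuclideanLin (Jmat gradc (x k ω)) (v k ω) = -(c (x k ω)) :=
    fun k ω => by rw [← hJp k ω, map_add, hJu, zero_add]
  have hvs : ∀ k ω, ‖v k ω‖ ≤ l1Norm (c (x k ω)) / s := fun k ω =>
    (norm_normal_step_le (hadj k ω) hs (hsv k ω) (hvrange k ω) (hJv k ω)).trans
      (div_le_div_of_nonneg_right (norm_le_l1Norm _) hs.le)
  have hv1 : ∀ k ω, ‖v k ω‖ ≤ κv * l1Norm (c (x k ω)) := fun k ω => by
    refine (hvs k ω).trans ?_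
    rw [div_eq_inv_mul, ← one_div]
    exact mul_le_mul_of_nonneg_right (hκv ▸ le_max_left _ _) (l1Norm_nonneg _)
  have hv2 : ∀ k ω, ‖v k ω‖ ^ 2 ≤ κv * l1Norm (c (x k ω)) := fun k ω => by
    have h0 := l1Norm_nonneg (c (x k ω))
    calc ‖v k ω‖ ^ 2 ≤ (l1Norm (c (x k ω)) / s) ^ 2 :=
          pow_le_pow_left₀ (norm_nonneg _) (hvs k ω) 2
      _ = l1Norm (c (x k ω)) / s ^ 2 * l1Norm (c (x k ω)) := by ring
      _ ≤ κc / s ^ 2 * l1Norm (c (x k ω)) := by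
          gcongr
          exact hcb _
      _ ≤ κv * l1Norm (c (x k ω)) := by
          gcongr
          exact hκv ▸ le_max_right _ _
  have hvb : ∀ k ω, ‖v k ω‖ ≤ κv * κc := fun k ω =>
    (hv1 k ω).trans (mul_le_mul_of_nonneg_left (hcb _) hκv0.le)
  have hsyst' : ∀ k ω, Matrix.toEuclideanLin (H k ω) (utrue k ω)
      + Matrix.toEuclideanLin (Jmat gradc (x k ω))ᵀ (ytrue k ω)
      = -(gradf (x k ω)) - Matrix.toEuclideanLin (H k ω) (v k ω) := fun k ω => by
    rw [← hsyst k ω, map_add]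
    abel
  have hutb : ∀ k ω, ‖utrue k ω‖ ≤ κu := fun k ω => by
    have h1 := mul_norm_le_of_kkt (hadj k ω) (hHpd k ω) (hJut k ω) (hsyst' k ω)
    have h2 := norm_sub_le (-(gradf (x k ω))) (Matrix.toEuclideanLin (H k ω) (v k ω))
    rw [norm_neg] at h2
    have h3 := (hHnorm k ω (v k ω)).trans (mul_le_mul_of_nonneg_left (hvb k ω) hκH.le)
    have h4 : ζ * ‖utrue k ω‖ ≤ κg + κH * (κv * κc) := by linarith [hgradb (x k ω)]
    have h5 : κu = ζ⁻¹ * (κg + κH * (κv * κc)) := by rw [hκu]; ring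
    rw [h5, ← div_eq_inv_mul, le_div_iff₀ hζ, mul_comm]
    exact h4
  have hut2 : ∀ k ω, ‖utrue k ω‖ ^ 2 ≤ ζ⁻¹ * κH * κu ^ 2 := fun k ω => by
    have h1 := hHpd k ω _ (hJut k ω)
    have h2 := real_inner_le_norm (utrue k ω) (Matrix.toEuclideanLin (H k ω) (utrue k ω))
    have h3 := mul_le_mul_of_nonneg_left (hHnorm k ω (utrue k ω)) (norm_nonneg (utrue k ω))
    have h4 : ‖utrue k ω‖ ^ 2 ≤ κu ^ 2 := pow_le_pow_left₀ (norm_nonneg _) (hutb k ω) 2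
    rw [mul_assoc, ← div_eq_inv_mul, le_div_iff₀ hζ]
    linarith [mul_le_mul_of_nonneg_left h4 hκH.le]
  have hδJ : ∀ k ω, Matrix.toEuclideanLin (Jmat gradc (x k ω)) (u k ω - utrue k ω) = 0 :=
    fun k ω => by rw [map_sub, hJu, hJut, sub_zero]
  have hδsys : ∀ k ω, Matrix.toEuclideanLin (H k ω) (u k ω - utrue k ω)
      + Matrix.toEuclideanLin (Jmat gradc (x k ω))ᵀ (y k ω - ytrue k ω)
      = -(g k ω - gradf (x k ω)) := fun k ω => by
    rw [neg_sub, ← neg_neg (gradf (x k ω)), ← hsyst k ω, ← neg_neg (g k ω), ← hsys k ω]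
    simp only [map_add, map_sub]
    abel
  have hδb : ∀ k ω, ‖u k ω - utrue k ω‖ ≤ ζ⁻¹ * ‖g k ω - gradf (x k ω)‖ := fun k ω => by
    have h1 := mul_norm_le_of_kkt (hadj k ω) (hHpd k ω) (hδJ k ω) (hδsys k ω)
    rw [norm_neg] at h1
    rw [← div_eq_inv_mul, le_div_iff₀ hζ, mul_comm]
    exact h1
  -- the stochastic gradient noise
  have hemeas : ∀ k, StronglyMeasurable fun ω => g k ω - gradf (x k ω) := fun k =>
    ((hgmeas k).mono (ℱ.le _)).sub ((hgf k).mono (ℱ.le _))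
  have heint : ∀ k, Integrable (fun ω => g k ω - gradf (x k ω)) μ := fun k =>
    ((memLp_two_iff_integrable_sq_norm (hemeas k).aestronglyMeasurable).2
      (hgvarint k)).integrable (by norm_num)
  have hgfint : ∀ k, Integrable (fun ω => gradf (x k ω)) μ := fun k =>
    Integrable.of_bound ((hgf k).mono (ℱ.le _)).aestronglyMeasurable κg
      (ae_of_all _ fun ω => hgradb _)
  have hecond : ∀ k, μ[fun ω => g k ω - gradf (x k ω) | ℱ k] =ᵐ[μ] 0 := fun k => by
    have hgint : Integrable (g k) μ := by
      have := (heint k).add (hgfint k)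
      refine this.congr (ae_of_all _ fun ω => ?_)
      simp
    have h1 := condExp_sub hgint (hgfint k) (ℱ k)
    have h2 := condExp_of_stronglyMeasurable (ℱ.le k) (hgf k) (hgfint k)
    refine h1.trans ?_
    filter_upwards [hgmean k] with ω hω
    rw [Pi.sub_apply, h2, hω, sub_self, Pi.zero_apply]
  have hE2 : ∀ k, ∫ ω, ‖g k ω - gradf (x k ω)‖ ^ 2 ∂μ ≤ M := fun k =>
    integral_sq_le_of_condExp_le (ℱ.le k) (hgvar k)
  have hE1 : ∀ k, ∫ ω, ‖g k ω - gradf (x k ω)‖ ∂μ ≤ Real.sqrt M := fun k =>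
    integral_le_sqrt_of_integral_sq_le (heint k).norm (hgvarint k) hM (hE2 k)
  have hunc : ∀ k (a : Ω → EuclideanSpace ℝ (Fin n)) (C : ℝ), StronglyMeasurable[ℱ k] a →
      (∀ ω, ‖a ω‖ ≤ C) → Integrable (fun ω => ⟪a ω, u k ω - utrue k ω⟫) μ ∧
        ∫ ω, ⟪a ω, u k ω - utrue k ω⟫ ∂μ = 0 := fun k a C ha haC =>
    integral_inner_tangential_error_eq_zero (ℱ.le k) hs hζ
      (fun i j => (hHmeas k i j).measurable) (hJmeas k) ha haC (hHpd k) (hsv k) (heint k)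
      (hecond k) (hδJ k) (hδsys k)
  -- integrability of the merit function
  have hCint : ∀ k, Integrable (fun ω => l1Norm (c (x k ω))) μ := fun k =>
    Integrable.of_bound ((continuous_l1Norm.comp hcc).comp_stronglyMeasurable
      ((hxmeas k).mono (ℱ.le k))).aestronglyMeasurable κc
      (ae_of_all _ fun ω => by
        rw [Real.norm_of_nonneg (l1Norm_nonneg _)]
        exact hcb _)
  have hTint : ∀ k, Integrable (fun ω => ‖utrue k ω‖ ^ 2) μ := fun k =>
    Integrable.of_bound (((hutmeas k).mono (ℱ.le k)).norm.pow 2).aestronglyMeasurable (κu ^ 2)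
      (ae_of_all _ fun ω => by
        rw [Real.norm_of_nonneg (by positivity)]
        exact pow_le_pow_left₀ (norm_nonneg _) (hutb k ω) 2)
  have hfmv : ∀ z z', ‖f z' - f z‖ ≤ κg * ‖z' - z‖ := fun z z' =>
    convex_univ.norm_image_sub_le_of_norm_fderiv_le (𝕜 := ℝ)
      (fun w _ => (hf w).differentiableAt)
      (fun w _ => by
        rw [(hf w).hasFDerivAt.fderiv, LinearIsometryEquiv.norm_map]
        exact hgradb w) (Set.mem_univ z) (Set.mem_univ z')
  have hfmeas : ∀ k, StronglyMeasurable fun ω => f (x k ω) := fun k =>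
    hfc.comp_stronglyMeasurable ((hxmeas k).mono (ℱ.le k))
  have hfint : ∀ k, Integrable (fun ω => f (x k ω)) μ := by
    intro k
    induction k with
    | zero => simp [hx0]
    | succ k ih =>
      have hdiff : Integrable (fun ω => f (x (k + 1) ω) - f (x k ω)) μ := by
        refine Integrable.mono' (g := fun ω => κg * ((ν + θ * κβ) *
          (κβ * (κu + ζ⁻¹ * ‖g k ω - gradf (x k ω)‖) + κv * κc))) ?_
          ((hfmeas (k + 1)).sub (hfmeas k)).aestronglyMeasurable (ae_of_all _ fun ω => ?_)
        · exact (((((integrable_const κu).add ((heint k).norm.const_mul ζ⁻¹)).const_mul κβ).add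
            (integrable_const (κv * κc))).const_mul (ν + θ * κβ)).const_mul κg
        · refine (hfmv _ _).trans (mul_le_mul_of_nonneg_left ?_ hκg.le)
          rw [hupdate, add_sub_cancel_left, norm_smul, Real.norm_of_nonneg (hαb k ω).1]
          refine mul_le_mul (hαb k ω).2 ?_ (norm_nonneg _) (by positivity)
          refine (norm_add_le _ _).trans (add_le_add ?_ (hvb k ω))
          rw [norm_smul, Real.norm_of_nonneg (hβpos k).le]
          refine mul_le_mul (hβb k) ?_ (norm_nonneg _) hκβ.le
          rw [← add_sub_cancel (utrue k ω) (u k ω)]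
          exact (norm_add_le _ _).trans (add_le_add (hutb k ω) (hδb k ω))
      exact (ih.add hdiff).congr (ae_of_all _ fun ω => by simp)
  -- expected one-step decrease
  have hstep : ∀ k, ∫ ω, (τmin * f (x (k + 1) ω) + l1Norm (c (x (k + 1) ω))) ∂μ
      + ν * τmin * β k * ζ * ∫ ω, ‖utrue k ω‖ ^ 2 ∂μ
      + ν * σ / 2 * ∫ ω, l1Norm (c (x k ω)) ∂μ
      ≤ ∫ ω, (τmin * f (x k ω) + l1Norm (c (x k ω))) ∂μ + β k ^ 2 * κ₁ := by
    intro k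
    obtain ⟨hDint, hD0⟩ := hunc k _ κg (hgf k) fun ω => hgradb _
    obtain ⟨hXint, hX0⟩ := hunc k _ κu (hutmeas k) (hutb k)
    have key := integral_descent_of_pointwise_descent
      (((hfint (k + 1)).const_mul τmin).add (hCint (k + 1)))
      (((hfint k).const_mul τmin).add (hCint k)) (hTint k) (hCint k) hDint hXint
      (heint k).norm (hgvarint k) hD0 hX0 (hE1 k) (hE2 k)
      (t := ν * τmin * β k * ζ) (c := ν * σ / 2) (a₁ := ν * τmin * β k)
      (a₂ := (ν + θ * κβ) ^ 2 * (τmin * L + Γ) * β k ^ 2)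
      (a₃ := τmin * θ * β k ^ 2 * κg * ζ⁻¹)
      (a₄ := (ν + θ * κβ) ^ 2 * (τmin * L + Γ) * β k ^ 2 / 2 * ζ⁻¹ ^ 2)
      (a₅ := β k ^ 2 * θ ^ 2 * κc * (κv * (τmin * L + Γ) + 4)
        + (ν + θ * κβ) ^ 2 * (τmin * L + Γ) * β k ^ 2 / 2 * (ζ⁻¹ * κH * κu ^ 2))
      (by positivity) (by positivity) ?_
    · refine key.trans (le_of_eq ?_)
      rw [hκ₁]
      simp only [Pi.add_apply]
      ring
    · intro ω
      have huv : ⟪u k ω, v k ω⟫ = 0 := by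
        obtain ⟨z, hz⟩ := hvrange k ω
        rw [hz]
        exact inner_range_adjoint_eq_zero (hadj k ω) (hJu k ω) z
      have hd : ‖β k • u k ω + v k ω‖ ^ 2 = β k ^ 2 * ‖u k ω‖ ^ 2 + ‖v k ω‖ ^ 2 := by
        rw [norm_add_sq_real, inner_smul_left, huv, norm_smul, mul_pow, Real.norm_eq_abs, sq_abs]
        simp
      have hJd : Matrix.toEuclideanLin (Jmat gradc (x k ω)) (β k • u k ω + v k ω)
          = -(c (x k ω)) := by rw [map_add, map_smul, hJu, smul_zero, zero_add, hJv]
      have hu2 : ‖u k ω‖ ^ 2 = ‖utrue k ω‖ ^ 2 + 2 * ⟪utrue k ω, u k ω - utrue k ω⟫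
          + ‖u k ω - utrue k ω‖ ^ 2 := by
        rw [← norm_add_sq_real, add_sub_cancel]
      have hF := le_quadratic_of_lipschitz_gradient hf hfLip (x k ω)
        (α k ω • (β k • u k ω + v k ω))
      rw [← hupdate, inner_smul_right, inner_add_right, inner_smul_right, norm_smul, mul_pow,
        Real.norm_eq_abs, sq_abs, hd, ← add_sub_cancel (utrue k ω) (u k ω), inner_add_right,
        add_sub_cancel] at hF
      have hC := l1Norm_step_le hc hcLip hJd (α k ω)
      rw [← hupdate, ← hΓ, hd] at hC
      have hδ2 : ‖u k ω - utrue k ω‖ ^ 2 ≤ ζ⁻¹ ^ 2 * ‖g k ω - gradf (x k ω)‖ ^ 2 := by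
        rw [← mul_pow]
        exact pow_le_pow_left₀ (norm_nonneg _) (hδb k ω) 2
      have hD : ⟪gradf (x k ω), u k ω - utrue k ω⟫ ≤ κg * (ζ⁻¹ * ‖g k ω - gradf (x k ω)‖) :=
        (real_inner_le_norm _ _).trans
          (mul_le_mul (hgradb _) (hδb k ω) (norm_nonneg _) hκg.le)
      have hG : ⟪gradf (x k ω), utrue k ω⟫ ≤ -(ζ * ‖utrue k ω‖ ^ 2) + κH * κu * ‖v k ω‖ := by
        have h1 := inner_eq_of_kkt (hadj k ω) (hJut k ω) (hsyst' k ω)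
        rw [inner_sub_right, inner_neg_right, real_inner_comm] at h1
        have h2 := hHpd k ω _ (hJut k ω)
        have h3 := neg_le_of_abs_le
          (abs_real_inner_le_norm (utrue k ω) (Matrix.toEuclideanLin (H k ω) (v k ω)))
        have h4 := mul_le_mul (hutb k ω) (hHnorm k ω (v k ω)) (norm_nonneg _) hκu0.le
        rw [real_inner_comm] at h1
        rw [real_inner_comm]
        linarith
      have hGv : ⟪gradf (x k ω), v k ω⟫ ≤ κg * ‖v k ω‖ :=
        (real_inner_le_norm _ _).trans
          (mul_le_mul_of_nonneg_right (hgradb _) (norm_nonneg _))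
      have hmodel : τmin * (β k * ⟪gradf (x k ω), utrue k ω⟫ + ⟪gradf (x k ω), v k ω⟫)
          ≤ -(τmin * β k * ζ * ‖utrue k ω‖ ^ 2) + (1 - σ) * l1Norm (c (x k ω)) := by
        have h0 : τmin * ((κβ * κH * κu + κg) * κv) = 1 - σ := by
          rw [hτmin]
          field_simp
        have h1 : β k * ⟪gradf (x k ω), utrue k ω⟫
            ≤ -(β k * ζ * ‖utrue k ω‖ ^ 2) + κβ * κH * κu * ‖v k ω‖ := by
          have h2 := mul_le_mul_of_nonneg_left hG (hβpos k).le
          have h3 : β k * (κH * κu * ‖v k ω‖) ≤ κβ * (κH * κu * ‖v k ω‖) :=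
            mul_le_mul_of_nonneg_right (hβb k) (by positivity)
          linarith
        have h2 := mul_le_mul_of_nonneg_left (hv1 k ω)
          (show 0 ≤ κβ * κH * κu + κg by positivity)
        rw [← h0]
        have h3 := mul_le_mul_of_nonneg_left
          (show β k * ⟪gradf (x k ω), utrue k ω⟫ + ⟪gradf (x k ω), v k ω⟫
            ≤ -(β k * ζ * ‖utrue k ω‖ ^ 2)
              + (κβ * κH * κu + κg) * (κv * l1Norm (c (x k ω))) by linarith) hτ.le
        linarith
      exact merit_step_le (L := L) (Γ := Γ) (θ := θ) (κv := κv) hν0 hθ (hβpos k) (hβb k) hσ0 hτ hL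
        hΓ0 hζ hκv0 (hα k ω) hνb' hF hC hmodel hD (by positivity) (by positivity) (hv2 k ω)
        (l1Norm_nonneg _) (hcb _) (by positivity) (by linarith [hut2 k ω])
  -- summation
  have hsum : ∀ N, ∫ ω, (τmin * f (x N ω) + l1Norm (c (x N ω))) ∂μ
      + ∑ k ∈ Finset.range N, (ν * τmin * β k * ζ * ∫ ω, ‖utrue k ω‖ ^ 2 ∂μ
        + ν * σ / 2 * ∫ ω, l1Norm (c (x k ω)) ∂μ)
      ≤ τmin * f x0 + l1Norm (c x0) + ∑ k ∈ Finset.range N, β k ^ 2 * κ₁ := by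
    intro N
    induction N with
    | zero => simp [hx0]
    | succ N ih =>
      rw [Finset.sum_range_succ, Finset.sum_range_succ]
      linarith [hstep N]
  have hlow : τmin * flow ≤ ∫ ω, (τmin * f (x K ω) + l1Norm (c (x K ω))) ∂μ := by
    have := integral_mono (integrable_const (τmin * flow))
      (((hfint K).const_mul τmin).add (hCint K)) (μ := μ) fun ω =>
        le_add_of_le_of_nonneg (mul_le_mul_of_nonneg_left (hflow (x K ω)) hτ.le)
          (l1Norm_nonneg (c (x K ω)))
    simpa using this
  have hK0 : (0 : ℝ) < K := by exact_mod_cast hK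
  have hsK : 0 < Real.sqrt K := Real.sqrt_pos.2 hK0
  have hsK2 : Real.sqrt K ^ 2 = K := Real.sq_sqrt hK0.le
  obtain ⟨S, hS⟩ : ∃ S, S = ∑ k ∈ Finset.range K, ∫ ω, ‖utrue k ω‖ ^ 2 ∂μ := ⟨_, rfl⟩
  obtain ⟨R, hR⟩ : ∃ R, R = ∑ k ∈ Finset.range K, ∫ ω, l1Norm (c (x k ω)) ∂μ := ⟨_, rfl⟩
  have hS0 : 0 ≤ S := hS ▸ Finset.sum_nonneg fun k _ => integral_nonneg fun ω => sq_nonneg _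
  have hR0 : 0 ≤ R := hR ▸ Finset.sum_nonneg fun k _ => integral_nonneg fun ω => l1Norm_nonneg _
  have hmain : ν * τmin * (η / Real.sqrt K) * ζ * S + ν * σ / 2 * R ≤ κ₂ := by
    have h1 := hsum K
    have h2 : ∑ k ∈ Finset.range K, β k ^ 2 * κ₁ = η ^ 2 * κ₁ := by
      rw [Finset.sum_congr rfl fun k hk => by rw [hβK k (Finset.mem_range.1 hk)],
        Finset.sum_const, Finset.card_range, nsmul_eq_mul, div_pow, hsK2]
      field_simp
    have h3 : ∑ k ∈ Finset.range K, (ν * τmin * β k * ζ * ∫ ω, ‖utrue k ω‖ ^ 2 ∂μ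
        + ν * σ / 2 * ∫ ω, l1Norm (c (x k ω)) ∂μ)
        = ν * τmin * (η / Real.sqrt K) * ζ * S + ν * σ / 2 * R := by
      rw [hS, hR, Finset.mul_sum, Finset.mul_sum, ← Finset.sum_add_distrib]
      exact Finset.sum_congr rfl fun k hk => by rw [hβK k (Finset.mem_range.1 hk)]
    rw [h2, h3] at h1
    rw [hκ₂]
    linarith
  have hsq : ∀ k, ∫ ω, ‖gradf (x k ω)
      + Matrix.toEuclideanLin (Jmat gradc (x k ω))ᵀ (ytrue k ω)‖ ^ 2 ∂μ
      ≤ κH ^ 2 * (∫ ω, ‖utrue k ω‖ ^ 2 ∂μ + κv * ∫ ω, l1Norm (c (x k ω)) ∂μ) := by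
    intro k
    rw [← integral_const_mul, ← integral_add (hTint k) ((hCint k).const_mul κv),
      ← integral_const_mul]
    refine integral_mono_of_nonneg (ae_of_all _ fun ω => sq_nonneg _)
      (((hTint k).add ((hCint k).const_mul κv)).const_mul (κH ^ 2)) (ae_of_all _ fun ω => ?_)
    have h1 : gradf (x k ω) + Matrix.toEuclideanLin (Jmat gradc (x k ω))ᵀ (ytrue k ω)
        = -(Matrix.toEuclideanLin (H k ω) (utrue k ω + v k ω)) := by
      rw [← neg_neg (gradf (x k ω)), ← hsyst k ω]
      abel
    have h2 : ⟪utrue k ω, v k ω⟫ = 0 := by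
      obtain ⟨z, hz⟩ := hvrange k ω
      rw [hz]
      exact inner_range_adjoint_eq_zero (hadj k ω) (hJut k ω) z
    simp only
    rw [h1, norm_neg]
    calc ‖Matrix.toEuclideanLin (H k ω) (utrue k ω + v k ω)‖ ^ 2
        ≤ (κH * ‖utrue k ω + v k ω‖) ^ 2 :=
          pow_le_pow_left₀ (norm_nonneg _) (hHnorm k ω _) 2
      _ = κH ^ 2 * (‖utrue k ω‖ ^ 2 + ‖v k ω‖ ^ 2) := by
          rw [mul_pow, norm_add_sq_real, h2]
          ring
      _ ≤ κH ^ 2 * (‖utrue k ω‖ ^ 2 + κv * l1Norm (c (x k ω))) := by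
          gcongr
          exact hv2 k ω
  have hS1 : S ≤ κ₂ / (ν * τmin * (η / Real.sqrt K) * ζ) := by
    rw [le_div_iff₀ (by positivity), mul_comm]
    have : 0 ≤ ν * σ / 2 * R := by positivity
    linarith
  have hR1 : R ≤ 2 * κ₂ / (ν * σ) := by
    rw [le_div_iff₀ (by positivity)]
    have : 0 ≤ ν * τmin * (η / Real.sqrt K) * ζ * S := by positivity
    linarith
  have hκ₂0 : 0 ≤ κ₂ := by
    refine le_trans ?_ hmain
    positivity
  calc (1 / (K : ℝ)) * ∑ k ∈ Finset.range K, ∫ ω, ‖gradf (x k ω)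
        + Matrix.toEuclideanLin (Jmat gradc (x k ω))ᵀ (ytrue k ω)‖ ^ 2 ∂μ
      ≤ (1 / (K : ℝ)) * (κH ^ 2 * (S + κv * R)) := by
        refine mul_le_mul_of_nonneg_left ?_ (by positivity)
        rw [hS, hR, Finset.mul_sum, ← Finset.sum_add_distrib, Finset.mul_sum]
        exact Finset.sum_le_sum fun k _ => hsq k
    _ ≤ (1 / (K : ℝ)) * (κH ^ 2 * (κ₂ / (ν * τmin * (η / Real.sqrt K) * ζ)
          + κv * (2 * κ₂ / (ν * σ)))) := by gcongr
    _ = κH ^ 2 * κ₂ / (τmin * ζ * ν * η * Real.sqrt K)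
          + 2 * 1 * κv * κH ^ 2 * κ₂ / (ν * σ * K) := by
        generalize Real.sqrt (K : ℝ) = q at hsK hsK2 ⊢
        rw [← hsK2]
        field_simp
    _ ≤ κH ^ 2 * κ₂ / (τmin * ζ * ν * η * Real.sqrt K)
          + 2 * (1 + 2 * κu) * κv * κH ^ 2 * κ₂ / (ν * σ * K) := by
        gcongr
        linarith
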